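/- The iterated-composition map is well defined on the universal enveloping algebra: the K-linear map Φ from the tensor algebra T(g•_A) to C^•(A) given on monomials by Φ(D₁⊗…⊗D_n) = (…((D₁∘D₂)∘D₃)…∘D_n) (and Φ(1) = 0 on the unit component, Φ(D) = D for n = 1) vanishes on the two-sided ideal of T(g•_A) generated by the elements D⊗E − (−1)^{(|D|+1)(|E|+1)} E⊗D − [D,E] for homogeneous D, E ∈ g•_A; hence it descends to a well-defined K-linear map U(g•_A) → C^•(A), Y ↦ Ȳ. -/

import Mathlib

/-!
Formalization of statements from B. Tsygan, "On the Gauss-Manin connection in cyclic homology".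

Setting: `K` is a commutative unital ring of characteristic zero, `A` a ℤ-graded unital
associative `K`-algebra, the grading given by submodules `𝒜 : ℤ → Submodule K A`
(`[GradedAlgebra 𝒜]`).

A homogeneous Hochschild `d`-cochain of internal degree `g` (a `K`-linear map
`Ā^{⊗d} → A` of degree `g`, `Ā = A/K·1`) is modeled by the structure `HCochain`:
its value on a tuple of homogeneous elements (each recorded together with its degree,
as an element of `ℤ × A`) is an element of `A`.  The conditions that such a map is
supported on its `d` arguments, multilinear, reduced (vanishes when an argument lies in
`K·1`), and homogeneous of degree `g` with respect to the grading `𝒜`, are recorded by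
the predicate `IsCochain`.  The total degree is `|D| = g + d = HCochain.tdeg`.
-/

noncomputable section

namespace CyclicGM

/-- The sign `(−1)^n` for an integer `n`. -/
def sgn (n : ℤ) : ℤ := if Even n then 1 else -1

variable {K : Type*} [CommRing K] [CharZero K]
variable {A : Type*} [Ring A] [Algebra K A]

/-- A (homogeneous) Hochschild cochain on a graded algebra `A`: `arity` is the number `d`
of arguments, `deg` the internal degree `g` of the underlying linear map, and `toFun`
the value on a tuple of homogeneous arguments, each given as (degree, element) ∈ ℤ × A.
(The arity is recorded as an integer so that formulas such as `d + e - 1` are exact.) -/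
structure HCochain (A : Type*) [Ring A] where
  arity : ℤ
  deg : ℤ
  toFun : (ℕ → ℤ × A) → A

/-- Padding cochain (used only as a junk default value). -/
def padC (A : Type*) [Ring A] : HCochain A := ⟨0, 0, fun _ => 0⟩

namespace HCochain

/-- The arity as a natural number. -/
def nar (D : HCochain A) : ℕ := D.arity.toNat

/-- The total degree `|D| = (degree of the linear map) + d`. -/
def tdeg (D : HCochain A) : ℤ := D.deg + D.arity

/-- `ksum a k = Σ_{i=1}^{k} (|a_i| + 1)` (0-indexed: first `k` arguments). -/
def ksum (a : ℕ → ℤ × A) (k : ℕ) : ℤ := ∑ i ∈ Finset.range k, ((a i).1 + 1)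

/-- The cup product
`(D ⌣ E)(a₁,…,a_{d+e}) = (−1)^{|E|·Σ_{i≤d}(|a_i|+1)} D(a₁,…,a_d)E(a_{d+1},…,a_{d+e})`. -/
def cup (D E : HCochain A) : HCochain A where
  arity := D.arity + E.arity
  deg := D.deg + E.deg
  toFun a := sgn (E.tdeg * ksum a D.nar) • (D.toFun a * E.toFun fun i => a (i + D.nar))

/-- Insert the value of `E` (evaluated on the block of arguments starting at position `j`)
as the `j`-th argument; the degree of the inserted homogeneous element is
`deg E + Σ (degrees of its arguments)`. -/
def insertArg (E : HCochain A) (j : ℕ) (a : ℕ → ℤ × A) : ℕ → ℤ × A := fun i =>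
  if i < j then a i
  else if i = j then
    (E.deg + ∑ t ∈ Finset.range E.nar, (a (j + t)).1, E.toFun fun t => a (j + t))
  else a (i + E.nar - 1)

/-- The Gerstenhaber composition
`(D∘E)(a₁,…,a_{d+e−1}) = Σ_j (−1)^{(|E|+1)·Σ_{i≤j}(|a_i|+1)} D(a₁,…,a_j,E(a_{j+1},…),…)`. -/
def comp (D E : HCochain A) : HCochain A where
  arity := D.arity + E.arity - 1
  deg := D.deg + E.deg
  toFun a := ∑ j ∈ Finset.range D.nar, sgn ((E.tdeg + 1) * ksum a j) • D.toFun (E.insertArg j a)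

/-- Scalar multiple (by an integer, e.g. a sign) of a cochain. -/
def zsmulC (c : ℤ) (D : HCochain A) : HCochain A := ⟨D.arity, D.deg, fun a => c • D.toFun a⟩

/-- Scalar multiple by an element of the ground ring. -/
def smulK (c : K) (D : HCochain A) : HCochain A := ⟨D.arity, D.deg, fun a => c • D.toFun a⟩

/-- Sum of two cochains (of the same arity and degree; bookkeeping fields from the first). -/
def addC (D E : HCochain A) : HCochain A := ⟨D.arity, D.deg, fun a => D.toFun a + E.toFun a⟩

/-- Difference of two cochains. -/
def subC (D E : HCochain A) : HCochain A := ⟨D.arity, D.deg, fun a => D.toFun a - E.toFun a⟩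

/-- The Gerstenhaber bracket `[D,E] = D∘E − (−1)^{(|D|+1)(|E|+1)} E∘D`. -/
def bracket (D E : HCochain A) : HCochain A :=
  subC (comp D E) (zsmulC (sgn ((D.tdeg + 1) * (E.tdeg + 1))) (comp E D))

end HCochain

/-- The multiplication cochain `m(a₁,a₂) = (−1)^{|a₁|} a₁a₂` (a 2-cochain of `A`). -/
def mC (A : Type*) [Ring A] : HCochain A :=
  ⟨2, 0, fun a => sgn (a 0).1 • ((a 0).2 * (a 1).2)⟩

/-- The Hochschild differential `δD = [m, D]`. -/
def deltaC {A : Type*} [Ring A] (D : HCochain A) : HCochain A := HCochain.bracket (mC A) D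

/-- `D` is (the restriction to homogeneous tuples of) a genuine Hochschild cochain, except
possibly for the sign of its arity: it depends only on its first `d` arguments, it is
homogeneous of degree `deg` with respect to the grading `𝒜`, it is `K`-multilinear,
and it vanishes when one of its arguments lies in `K·1` (i.e. it is defined on `Ā^{⊗d}`,
`Ā = A/K·1`). -/
structure IsPreCochain (𝒜 : ℤ → Submodule K A) (D : HCochain A) : Prop where
  supported : ∀ a b : ℕ → ℤ × A, (∀ i : ℕ, (i : ℤ) < D.arity → a i = b i) →
      D.toFun a = D.toFun b
  homog : ∀ a : ℕ → ℤ × A, (∀ i : ℕ, (i : ℤ) < D.arity → (a i).2 ∈ 𝒜 (a i).1) →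
      D.toFun a ∈ 𝒜 (D.deg + ∑ i ∈ Finset.range D.nar, (a i).1)
  map_add : ∀ (a : ℕ → ℤ × A) (j : ℕ), (j : ℤ) < D.arity → ∀ x y : A,
      D.toFun (Function.update a j ((a j).1, x + y)) =
        D.toFun (Function.update a j ((a j).1, x)) + D.toFun (Function.update a j ((a j).1, y))
  map_smul : ∀ (a : ℕ → ℤ × A) (j : ℕ), (j : ℤ) < D.arity → ∀ (c : K) (x : A),
      D.toFun (Function.update a j ((a j).1, c • x)) =
        c • D.toFun (Function.update a j ((a j).1, x))
  reduced : ∀ (a : ℕ → ℤ × A) (j : ℕ), (j : ℤ) < D.arity →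
      (∃ c : K, (a j).2 = algebraMap K A c) → D.toFun a = 0

/-- `D` is a genuine Hochschild cochain: a homogeneous element of `C^d(A)`, `d ≥ 0`. -/
structure IsCochain (𝒜 : ℤ → Submodule K A) (D : HCochain A) extends
    IsPreCochain 𝒜 D : Prop where
  arity_nonneg : 0 ≤ D.arity

end CyclicGM

namespace CyclicGM

open HCochain

/-- `Ȳ`: the iterated-composition map on monomials,
`Ȳ = (…((D₁∘D₂)∘D₃)…∘D_n)` (and `Ȳ = 0` on the empty monomial is irrelevant here;
for a one-element list it is that element). -/
def Ybar {A : Type*} [Ring A] : List (HCochain A) → HCochain A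
  | [] => padC A
  | D :: Ds => Ds.foldl comp D

theorem sgn_add (m n : ℤ) : sgn (m + n) = sgn m * sgn n := by
  unfold sgn
  by_cases hm : Even m <;> by_cases hn : Even n <;> simp [Int.even_add, hm, hn]

theorem sgn_mul_self (n : ℤ) : sgn n * sgn n = 1 := by
  unfold sgn
  split <;> simp

theorem sgn_eq_of_even_sub {m n : ℤ} (h : Even (m - n)) : sgn m = sgn n := by
  have h' := Int.even_sub.mp h
  simp only [sgn, h']

namespace HCochain

theorem ksum_eq {A : Type*} (a : ℕ → ℤ × A) (k : ℕ) :
    ksum a k = ∑ i ∈ Finset.range k, (a i).1 + k := by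
  simp [ksum, Finset.sum_add_distrib]

theorem ksum_congr {A : Type*} {a b : ℕ → ℤ × A} {k : ℕ} (h : ∀ i < k, (a i).1 = (b i).1) :
    ksum a k = ksum b k :=
  Finset.sum_congr rfl fun i hi => by rw [h i (Finset.mem_range.mp hi)]

theorem ksum_add {A : Type*} (a : ℕ → ℤ × A) (k l : ℕ) :
    ksum a (k + l) = ksum a k + ksum (fun t => a (k + t)) l := by
  simp only [ksum, Finset.sum_range_add]

variable {A : Type*} [Ring A]

/-- Additivity in each of the arguments. -/
def ArgAdditive (P : HCochain A) : Prop :=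
  ∀ (a : ℕ → ℤ × A) (j : ℕ), (j : ℤ) < P.arity → ∀ x y : A,
    P.toFun (Function.update a j ((a j).1, x + y)) =
      P.toFun (Function.update a j ((a j).1, x)) + P.toFun (Function.update a j ((a j).1, y))

/-- Dependence on the first `arity` arguments only. -/
def Supported (P : HCochain A) : Prop :=
  ∀ a b : ℕ → ℤ × A, (∀ i : ℕ, (i : ℤ) < P.arity → a i = b i) → P.toFun a = P.toFun b

/-- The value of `P` as an additive function of its `j`-th argument. -/
def ArgAdditive.hom {P : HCochain A} (hP : P.ArgAdditive) (a : ℕ → ℤ × A) (j : ℕ)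
    (hj : (j : ℤ) < P.arity) (g : ℤ) : A →+ A :=
  AddMonoidHom.mk' (fun x => P.toFun (Function.update a j (g, x))) (fun x y => by
    simpa using hP (Function.update a j (g, 0)) j hj x y)

theorem ArgAdditive.hom_apply {P : HCochain A} (hP : P.ArgAdditive) (a : ℕ → ℤ × A) (j : ℕ)
    (hj : (j : ℤ) < P.arity) (g : ℤ) (x : A) :
    hP.hom a j hj g x = P.toFun (Function.update a j (g, x)) := rfl

theorem insertArg_of_lt (E : HCochain A) {i j : ℕ} (a : ℕ → ℤ × A) (h : i < j) :
    E.insertArg j a i = a i := by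
  simp [insertArg, h]

theorem insertArg_self (E : HCochain A) (j : ℕ) (a : ℕ → ℤ × A) :
    E.insertArg j a j =
      (E.deg + ∑ t ∈ Finset.range E.nar, (a (j + t)).1, E.toFun fun t => a (j + t)) := by
  simp [insertArg]

theorem insertArg_of_gt (E : HCochain A) {i j : ℕ} (a : ℕ → ℤ × A) (h : j < i) :
    E.insertArg j a i = a (i + E.nar - 1) := by
  simp [insertArg, h.ne', h.not_gt]

theorem insertArg_add (E : HCochain A) (k l : ℕ) (a : ℕ → ℤ × A) :
    (fun t => E.insertArg (k + l) a (k + t)) = E.insertArg l (fun t => a (k + t)) := by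
  funext t
  rcases lt_trichotomy t l with h | rfl | h
  · rw [insertArg_of_lt _ _ h, insertArg_of_lt _ _ (by omega)]
  · simp only [insertArg_self, add_assoc]
  · rw [insertArg_of_gt _ _ h, insertArg_of_gt _ _ (by omega)]
    congr 1
    omega

theorem sum_insertArg_fst (E : HCochain A) (l n : ℕ) (a : ℕ → ℤ × A) (h : l < n) :
    ∑ t ∈ Finset.range n, (E.insertArg l a t).1 =
      E.deg + ∑ t ∈ Finset.range (n + E.nar - 1), (a t).1 := by
  obtain ⟨m, rfl⟩ : ∃ m, n = l + 1 + m := ⟨n - (l + 1), by omega⟩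
  clear h
  induction m with
  | zero =>
    rw [add_zero, Finset.sum_range_succ, insertArg_self,
      show l + 1 + E.nar - 1 = l + E.nar by omega, Finset.sum_range_add,
      Finset.sum_congr rfl fun t ht => by rw [insertArg_of_lt _ _ (Finset.mem_range.mp ht)]]
    ring
  | succ m ih =>
    rw [← add_assoc, Finset.sum_range_succ, ih, insertArg_of_gt _ _ (by omega),
      show l + 1 + m + 1 + E.nar - 1 = l + 1 + m + E.nar - 1 + 1 by omega,
      Finset.sum_range_succ]
    ring

theorem ksum_insertArg_of_le (E : HCochain A) {j k : ℕ} (a : ℕ → ℤ × A) (h : k ≤ j) :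
    ksum (E.insertArg j a) k = ksum a k :=
  ksum_congr fun _ hi => by rw [insertArg_of_lt _ _ (hi.trans_le h)]

theorem ksum_insertArg_of_gt (E : HCochain A) {j k : ℕ} (a : ℕ → ℤ × A) (h : j < k) :
    ksum (E.insertArg j a) k = ksum a (k + E.nar - 1) + E.deg - E.nar + 1 := by
  rw [ksum_eq, ksum_eq, sum_insertArg_fst _ _ _ _ h]
  have : ((k + E.nar - 1 : ℕ) : ℤ) = k + E.nar - 1 := by omega
  rw [this]
  ring

theorem nar_cast {E : HCochain A} (h : 0 ≤ E.arity) : (E.nar : ℤ) = E.arity :=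
  Int.toNat_of_nonneg h

theorem comp_nar {P D : HCochain A} (hD : 0 ≤ D.arity) (hP : 0 < P.nar) :
    (comp P D).nar = P.nar + D.nar - 1 := by
  simp only [nar, comp] at *
  omega

theorem comp_toFun (D E : HCochain A) (a : ℕ → ℤ × A) :
    (comp D E).toFun a = ∑ j ∈ Finset.range D.nar,
      sgn ((E.tdeg + 1) * ksum a j) • D.toFun (E.insertArg j a) := rfl

theorem Supported.congr_nar {E : HCochain A} (hE : E.Supported) {a b : ℕ → ℤ × A}
    (h : ∀ i < E.nar, a i = b i) : E.toFun a = E.toFun b :=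
  hE a b fun i hi => h i (by simp only [nar]; omega)

/-- Insertions at distinct positions commute. -/
theorem insertArg_insertArg (D E : HCochain A) (hD : D.Supported) {k m : ℕ} (h : k < m)
    (a : ℕ → ℤ × A) :
    D.insertArg k (E.insertArg (m + D.nar - 1) a) = E.insertArg m (D.insertArg k a) := by
  have hlt : ∀ t < D.nar, E.insertArg (m + D.nar - 1) a (k + t) = a (k + t) := fun t ht =>
    insertArg_of_lt _ _ (by omega)
  have hge : ∀ t, D.insertArg k a (m + t) = a (m + D.nar - 1 + t) := fun t => by
    rw [insertArg_of_gt _ _ (by omega)]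
    congr 1
    omega
  funext i
  rcases lt_trichotomy i k with hi | rfl | hi
  · rw [insertArg_of_lt _ _ hi, insertArg_of_lt _ _ (by omega), insertArg_of_lt _ _ (by omega),
      insertArg_of_lt _ _ hi]
  · rw [insertArg_self, insertArg_of_lt _ _ h, insertArg_self, hD.congr_nar hlt,
      Finset.sum_congr rfl fun t ht => by rw [hlt t (Finset.mem_range.mp ht)]]
  · rw [insertArg_of_gt _ _ hi]
    rcases lt_trichotomy i m with hm | rfl | hm
    · rw [insertArg_of_lt _ _ (by omega), insertArg_of_lt _ _ hm, insertArg_of_gt _ _ hi]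
    · simp only [insertArg_self, hge]
    · rw [insertArg_of_gt _ _ (by omega), insertArg_of_gt _ _ hm, insertArg_of_gt _ _ (by omega)]
      congr 1
      omega

theorem insertArg_update_of_lt (D : HCochain A) {j k : ℕ} (h : j < k)
    (a : ℕ → ℤ × A) (z : A) :
    D.insertArg k (Function.update a j ((a j).1, z)) =
      Function.update (D.insertArg k a) j ((D.insertArg k a j).1, z) := by
  have hs : ∀ t, k ≤ t → Function.update a j ((a j).1, z) t = a t := fun t ht =>
    Function.update_of_ne (by omega) _ _
  funext i
  rcases lt_trichotomy i k with hi | rfl | hi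
  · rw [insertArg_of_lt _ _ hi, insertArg_of_lt _ _ h]
    by_cases hij : i = j
    · subst hij; simp
    · simp [hij, insertArg_of_lt _ _ hi]
  · rw [Function.update_of_ne (by omega), insertArg_self, insertArg_self]
    simp only [hs _ (Nat.le_add_right _ _)]
  · rw [Function.update_of_ne (by omega), insertArg_of_gt _ _ hi, insertArg_of_gt _ _ hi,
      hs _ (by omega)]

theorem Supported.insertArg_update_of_ge {D : HCochain A} (hD : D.Supported) {j k : ℕ}
    (h : k + D.nar ≤ j) (a : ℕ → ℤ × A) (z : A) :
    D.insertArg k (Function.update a j ((a j).1, z)) =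
      Function.update (D.insertArg k a) (j + 1 - D.nar)
        ((D.insertArg k a (j + 1 - D.nar)).1, z) := by
  have hs : ∀ t, t ≠ j → Function.update a j ((a j).1, z) t = a t := fun t ht =>
    Function.update_of_ne ht _ _
  funext i
  rcases lt_trichotomy i k with hi | rfl | hi
  · rw [Function.update_of_ne (by omega), insertArg_of_lt _ _ hi, insertArg_of_lt _ _ hi,
      hs _ (by omega)]
  · rw [Function.update_of_ne (by omega), insertArg_self, insertArg_self,
      hD.congr_nar fun t ht => hs (i + t) (by omega),
      Finset.sum_congr rfl fun t ht => by rw [hs (i + t) (by have := Finset.mem_range.mp ht; omega)]]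
  · rw [insertArg_of_gt _ _ hi, insertArg_of_gt D a (show k < j + 1 - D.nar by omega),
      show j + 1 - D.nar + D.nar - 1 = j by omega]
    by_cases hij : i = j + 1 - D.nar
    · subst hij
      rw [show j + 1 - D.nar + D.nar - 1 = j by omega]
      simp
    · rw [Function.update_of_ne hij, insertArg_of_gt _ _ hi, hs _ (by omega)]

theorem insertArg_update_of_mem (D : HCochain A) {j k : ℕ} (h₁ : k ≤ j) (h₂ : j < k + D.nar)
    (a : ℕ → ℤ × A) (z : A) :
    D.insertArg k (Function.update a j ((a j).1, z)) =
      Function.update (D.insertArg k a) k ((D.insertArg k a k).1,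
        D.toFun (Function.update (fun t => a (k + t)) (j - k) ((a (k + (j - k))).1, z))) := by
  have hf : ∀ t, (Function.update a j ((a j).1, z) t).1 = (a t).1 := fun t => by
    by_cases ht : t = j
    · subst ht; simp
    · simp [ht]
  funext i
  rcases lt_trichotomy i k with hi | rfl | hi
  · rw [insertArg_of_lt _ _ hi, Function.update_of_ne (by omega), Function.update_of_ne (by omega),
      insertArg_of_lt _ _ hi]
  · rw [Function.update_self, insertArg_self, insertArg_self]
    simp only [hf]
    congr 2
    funext t
    by_cases ht : t = j - i
    · subst ht
      simp [h₁]
    · rw [Function.update_of_ne ht, Function.update_of_ne (by omega)]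
  · rw [insertArg_of_gt _ _ hi, Function.update_of_ne (by omega), Function.update_of_ne (by omega),
      insertArg_of_gt _ _ hi]

theorem ArgAdditive.comp {P D : HCochain A} (hP : P.ArgAdditive) (hD : D.ArgAdditive)
    (hs : D.Supported) (h0 : 0 ≤ D.arity) : (comp P D).ArgAdditive := by
  intro a j hj x y
  simp only [comp_toFun, ← Finset.sum_add_distrib]
  refine Finset.sum_congr rfl fun k hk => ?_
  have hkp : (k : ℤ) < P.arity := by
    have := Finset.mem_range.mp hk
    simp only [nar] at this
    omega
  have hd := nar_cast h0
  change (j : ℤ) < P.arity + D.arity - 1 at hj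
  have hf : ∀ z : A, ksum (Function.update a j ((a j).1, z)) k = ksum a k := fun z =>
    ksum_congr fun t _ => by
      by_cases ht : t = j
      · subst ht; simp
      · simp [ht]
  simp only [hf, ← smul_add]
  congr 1
  rcases lt_or_ge j k with h | h
  · simp only [insertArg_update_of_lt D h]
    exact hP _ _ (by omega) _ _
  rcases lt_or_ge j (k + D.nar) with h' | h'
  · simp only [insertArg_update_of_mem D h h']
    rw [hD (fun t => a (k + t)) (j - k) (by omega)]
    exact hP _ _ hkp _ _
  · simp only [hs.insertArg_update_of_ge h']
    exact hP _ _ (by omega) _ _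

/-- The term of `(P ∘ D) ∘ E` in which `E` is inserted at position `j`, then `D` at `k`. -/
def nestedTerm (P D E : HCochain A) (a : ℕ → ℤ × A) (j k : ℕ) : A :=
  sgn ((E.tdeg + 1) * ksum a j) • sgn ((D.tdeg + 1) * ksum (E.insertArg j a) k) •
    P.toFun (D.insertArg k (E.insertArg j a))

theorem nestedTerm_swap (P : HCochain A) {D E : HCochain A} (hD : D.Supported)
    (h0 : 0 ≤ D.arity) (a : ℕ → ℤ × A) {k m : ℕ} (h : k < m) :
    nestedTerm P D E a (m + D.nar - 1) k =
      sgn ((D.tdeg + 1) * (E.tdeg + 1)) • nestedTerm P E D a k m := by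
  unfold nestedTerm
  rw [insertArg_insertArg D E hD h, ksum_insertArg_of_le _ _ (by omega),
    ksum_insertArg_of_gt _ _ h]
  simp only [smul_smul, ← sgn_add]
  congr 1
  apply sgn_eq_of_even_sub
  rw [nar_cast h0]
  unfold tdeg
  refine ⟨-((E.deg + E.arity + 1) * (D.deg + 1)), ?_⟩
  ring

theorem comp_comp_toFun (P : HCochain A) {D E : HCochain A} (hD : D.Supported)
    (h0 : 0 ≤ D.arity) (a : ℕ → ℤ × A) :
    (comp (comp P D) E).toFun a =
      ∑ k ∈ Finset.range P.nar, ∑ j ∈ Finset.range k, nestedTerm P D E a j k +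
      ∑ k ∈ Finset.range P.nar, ∑ l ∈ Finset.range D.nar, nestedTerm P D E a (k + l) k +
      sgn ((D.tdeg + 1) * (E.tdeg + 1)) •
        ∑ k ∈ Finset.range P.nar, ∑ j ∈ Finset.range k, nestedTerm P E D a j k := by
  have hswap : ∑ k ∈ Finset.range P.nar, ∑ j ∈ Finset.range k, nestedTerm P E D a j k =
      ∑ k ∈ Finset.range P.nar, ∑ m ∈ Finset.Ico (k + 1) P.nar, nestedTerm P E D a k m := by
    refine Finset.sum_comm' fun x y => ?_
    simp only [Finset.mem_range, Finset.mem_Ico]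
    omega
  have hL : (comp (comp P D) E).toFun a = ∑ k ∈ Finset.range P.nar,
      ∑ j ∈ Finset.range (comp P D).nar, nestedTerm P D E a j k := by
    rw [Finset.sum_comm, comp_toFun]
    simp only [comp_toFun, Finset.smul_sum, nestedTerm]
  rw [hswap, hL, Finset.smul_sum, ← Finset.sum_add_distrib, ← Finset.sum_add_distrib]
  refine Finset.sum_congr rfl fun k hk => ?_
  have hk := Finset.mem_range.mp hk
  rw [comp_nar h0 (by omega), Finset.smul_sum,
    ← Finset.sum_congr rfl fun m hm => nestedTerm_swap P hD h0 a (Finset.mem_Ico.mp hm).1,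
    Finset.sum_Ico_eq_sum_range,
    show P.nar + D.nar - 1 = k + D.nar + (P.nar - (k + 1)) by omega,
    Finset.sum_range_add, Finset.sum_range_add]
  congr 1
  refine Finset.sum_congr rfl fun m _ => ?_
  congr 1
  omega

theorem insertArg_insertArg_of_mem (D E : HCochain A) (h0 : 0 ≤ E.arity) {l : ℕ}
    (hl : l < D.nar) (k : ℕ) (a : ℕ → ℤ × A) :
    D.insertArg k (E.insertArg (k + l) a) =
      Function.update ((comp D E).insertArg k a) k (((comp D E).insertArg k a k).1,
        D.toFun (E.insertArg l fun t => a (k + t))) := by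
  have hn := comp_nar h0 (P := D) (by omega)
  funext i
  rcases lt_trichotomy i k with hi | rfl | hi
  · rw [Function.update_of_ne hi.ne, insertArg_of_lt _ _ hi, insertArg_of_lt _ _ hi,
      insertArg_of_lt _ _ (by omega)]
  · rw [Function.update_self, insertArg_self, insertArg_self, hn, insertArg_add]
    congr 1
    have := sum_insertArg_fst E l D.nar (fun t => a (i + t)) hl
    rw [← insertArg_add] at this
    change D.deg + _ = D.deg + E.deg + _
    rw [this]
    ring
  · rw [Function.update_of_ne hi.ne', insertArg_of_gt _ _ hi, insertArg_of_gt _ _ hi,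
      insertArg_of_gt _ _ (by omega), hn]
    congr 1
    omega

/-- The terms of `(P ∘ D) ∘ E` with `E` inserted into `D` sum to `P ∘ (D ∘ E)`. -/
theorem sum_nestedTerm_mem {P D E : HCochain A} (hP : P.ArgAdditive)
    (h0 : 0 ≤ E.arity) {k : ℕ} (hk : (k : ℤ) < P.arity) (a : ℕ → ℤ × A) :
    ∑ l ∈ Finset.range D.nar, nestedTerm P D E a (k + l) k =
      sgn (((comp D E).tdeg + 1) * ksum a k) • P.toFun ((comp D E).insertArg k a) := by
  have h : (comp D E).insertArg k a = Function.update ((comp D E).insertArg k a) k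
      (((comp D E).insertArg k a k).1, (comp D E).toFun fun t => a (k + t)) := by
    conv_lhs => rw [← Function.update_eq_self k ((comp D E).insertArg k a)]
    rw [insertArg_self]
  rw [h, ← hP.hom_apply _ _ hk, comp_toFun, map_sum, Finset.smul_sum]
  refine Finset.sum_congr rfl fun l hl => ?_
  rw [nestedTerm, insertArg_insertArg_of_mem D E h0 (Finset.mem_range.mp hl), map_zsmul,
    hP.hom_apply, ksum_insertArg_of_le _ _ (by omega), ksum_add]
  simp only [smul_smul, ← sgn_add]
  congr 1
  apply sgn_eq_of_even_sub
  simp only [tdeg, comp]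
  refine ⟨ksum a k, ?_⟩
  ring

theorem comp_toFun_bracket {P D E : HCochain A} (hP : P.ArgAdditive) (a : ℕ → ℤ × A) :
    (comp P (bracket D E)).toFun a = (comp P (comp D E)).toFun a -
      sgn ((D.tdeg + 1) * (E.tdeg + 1)) • (comp P (comp E D)).toFun a := by
  simp only [comp_toFun P, Finset.smul_sum, ← Finset.sum_sub_distrib]
  refine Finset.sum_congr rfl fun k hk => ?_
  have hkp : (k : ℤ) < P.arity := by
    have := Finset.mem_range.mp hk
    simp only [nar] at this
    omega
  have har : (comp E D).arity = (comp D E).arity := by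
    simp only [comp]; ring
  have hdeg : (comp E D).deg = (comp D E).deg := add_comm _ _
  have ht : (comp E D).tdeg = (comp D E).tdeg := by
    simp only [tdeg, har, hdeg]
  have hb : (bracket D E).tdeg = (comp D E).tdeg := rfl
  have h : ∀ F : HCochain A, F.arity = (comp D E).arity → F.deg = (comp D E).deg →
      P.toFun (F.insertArg k a) = hP.hom ((comp D E).insertArg k a) k hkp
        ((comp D E).insertArg k a k).1 (F.toFun fun t => a (k + t)) := by
    intro F h₁ h₂
    rw [hP.hom_apply]
    congr 1
    have hn : F.nar = (comp D E).nar := by simp only [nar, h₁]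
    funext i
    rcases lt_trichotomy i k with hi | rfl | hi
    · rw [Function.update_of_ne hi.ne, insertArg_of_lt _ _ hi, insertArg_of_lt _ _ hi]
    · rw [Function.update_self, insertArg_self, insertArg_self, hn, h₂]
    · rw [Function.update_of_ne hi.ne', insertArg_of_gt _ _ hi, insertArg_of_gt _ _ hi, hn]
  rw [h _ har hdeg, h (comp D E) rfl rfl, h (bracket D E) rfl rfl, hb, ht]
  change _ • hP.hom _ _ _ _ ((comp D E).toFun _ - _ • (comp E D).toFun _) = _
  rw [map_sub, map_zsmul, smul_sub, smul_comm]

/-- The (graded, right) pre-Lie identity for the composition of cochains. -/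
theorem comp_comp_sub_comp_comp {P D E : HCochain A} (hP : P.ArgAdditive)
    (hD : D.Supported) (hE : E.Supported) (hD0 : 0 ≤ D.arity) (hE0 : 0 ≤ E.arity)
    (a : ℕ → ℤ × A) :
    (comp (comp P D) E).toFun a -
        sgn ((D.tdeg + 1) * (E.tdeg + 1)) • (comp (comp P E) D).toFun a =
      (comp P (bracket D E)).toFun a := by
  have hmem : ∀ {D E : HCochain A}, 0 ≤ E.arity →
      ∑ k ∈ Finset.range P.nar, ∑ l ∈ Finset.range D.nar, nestedTerm P D E a (k + l) k =
        (comp P (comp D E)).toFun a := by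
    intro D E h0
    refine Finset.sum_congr rfl fun k hk => sum_nestedTerm_mem hP h0 ?_ a
    have := Finset.mem_range.mp hk
    simp only [nar] at this
    omega
  rw [comp_comp_toFun P hD hD0, comp_comp_toFun P hE hE0, comp_toFun_bracket hP, hmem hE0,
    hmem hD0, mul_comm (E.tdeg + 1)]
  simp only [smul_add, smul_smul, sgn_mul_self, one_smul]
  abel

/-- Iterated composition is linear in its first entry. -/
theorem foldl_comp_toFun_sub {X Y Z : HCochain A} (c : ℤ) (Ws : List (HCochain A))
    (hY : Y.arity = X.arity) (hZ : Z.arity = X.arity)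
    (h : ∀ a, X.toFun a - c • Y.toFun a = Z.toFun a) (a : ℕ → ℤ × A) :
    (Ws.foldl comp X).toFun a - c • (Ws.foldl comp Y).toFun a = (Ws.foldl comp Z).toFun a := by
  induction Ws generalizing X Y Z with
  | nil => exact h a
  | cons W Ws ih =>
    refine ih (by simp only [comp, hY]) (by simp only [comp, hZ]) fun b => ?_
    simp only [comp_toFun, nar, hY, hZ, Finset.smul_sum, ← Finset.sum_sub_distrib]
    refine Finset.sum_congr rfl fun j _ => ?_
    rw [← h, smul_sub, smul_comm c]

end HCochain

theorem IsCochain.argAdditive_foldl {K : Type*} [CommRing K]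
    {A : Type*} [Ring A] [Algebra K A] {𝒜 : ℤ → Submodule K A} {P : HCochain A}
    (hP : P.ArgAdditive) (Ds : List (HCochain A)) (hDs : ∀ X ∈ Ds, IsCochain 𝒜 X) :
    (Ds.foldl comp P).ArgAdditive := by
  induction Ds generalizing P with
  | nil => exact hP
  | cons D Ds ih =>
    have hD := hDs D (by simp)
    exact ih (hP.comp hD.map_add hD.supported hD.arity_nonneg)
      fun X hX => hDs X (by simp [hX])

/-- The iterated-composition map `Φ(D₁⊗…⊗D_n) = (…(D₁∘D₂)…∘D_n)`
vanishes on the two-sided ideal of the tensor algebra `T(g•_A)` generated by the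
elements `D⊗E − (−1)^{(|D|+1)(|E|+1)} E⊗D − [D,E]`: for any monomials `pre`, `post`
and homogeneous cochains `D, E`,
`Φ(pre⊗D⊗E⊗post) − (−1)^{(|D|+1)(|E|+1)} Φ(pre⊗E⊗D⊗post) − Φ(pre⊗[D,E]⊗post) = 0`.
Hence `Φ` descends to a well-defined `K`-linear map `U(g•_A) → C^•(A)`, `Y ↦ Ȳ`. -/
theorem Ybar_well_defined {K : Type*} [CommRing K] [CharZero K]
    {A : Type*} [Ring A] [Algebra K A]
    (𝒜 : ℤ → Submodule K A) [GradedAlgebra 𝒜]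
    (pre post : List (HCochain A)) (D E : HCochain A)
    (hpre : ∀ X ∈ pre, IsCochain 𝒜 X) (hpost : ∀ X ∈ post, IsCochain 𝒜 X)
    (hD : IsCochain 𝒜 D) (hE : IsCochain 𝒜 E) :
    subC (subC (Ybar (pre ++ [D, E] ++ post))
        (zsmulC (sgn ((D.tdeg + 1) * (E.tdeg + 1))) (Ybar (pre ++ [E, D] ++ post))))
      (Ybar (pre ++ [bracket D E] ++ post)) =
    ⟨(Ybar (pre ++ [D, E] ++ post)).arity, (Ybar (pre ++ [D, E] ++ post)).deg,
      fun _ => 0⟩ := by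
  have key : ∀ X Y Z : HCochain A, Y.arity = X.arity → Z.arity = X.arity →
      (∀ a, X.toFun a - sgn ((D.tdeg + 1) * (E.tdeg + 1)) • Y.toFun a = Z.toFun a) →
      subC (subC (post.foldl comp X)
          (zsmulC (sgn ((D.tdeg + 1) * (E.tdeg + 1))) (post.foldl comp Y)))
        (post.foldl comp Z) =
      ⟨(post.foldl comp X).arity, (post.foldl comp X).deg, fun _ => 0⟩ := by
    intro X Y Z hY hZ h
    simp only [subC, zsmulC, HCochain.mk.injEq, true_and]
    funext a
    exact sub_eq_zero.mpr (foldl_comp_toFun_sub _ post hY hZ h a)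
  cases pre with
  | nil =>
    exact key (comp D E) (comp E D) (bracket D E) (by simp only [comp]; ring) rfl fun _ => rfl
  | cons P Ps =>
    have hP : (Ps.foldl comp P).ArgAdditive :=
      IsCochain.argAdditive_foldl (hpre P (by simp)).map_add Ps
        fun X hX => hpre X (by simp [hX])
    simp only [Ybar, List.cons_append, List.foldl_append, List.foldl_cons, List.foldl_nil]
    refine key _ _ _ ?_ ?_ (comp_comp_sub_comp_comp hP hD.supported hE.supported
      hD.arity_nonneg hE.arity_nonneg)
    · simp only [comp]; ring
    · simp only [comp, bracket, subC]; ring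

end CyclicGM
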